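/- Let (V,c,s,t) be a flow network, let ρ be a preflow (0 ≤ ρ ≤ c pointwise), and let η : V × V → ℝ satisfy 0 ≤ η(u,v) ≤ c_ρ(u,v) for all u,v, where c_ρ(u,v) = c(u,v) − ρ(u,v) + ρ(v,u). Define (ρ ⊕ η)(u,v) = max(0, ρ(u,v) + η(u,v) − ρ(v,u) − η(v,u)). Then: (a) 0 ≤ (ρ ⊕ η)(u,v) ≤ c(u,v) for all u,v; (b) ex(ρ ⊕ η, v) = ex(ρ,v) + ex(η,v) for every vertex v; and (c) c_{ρ⊕η}(u,v) = c_ρ(u,v) − η(u,v) + η(v,u) for all u,v. In particular, if ex(ρ,v) ≥ 0 and ex(η,v) ≥ 0 for every v ≠ s, then ρ ⊕ η is a feasible preflow. -/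

import Mathlib

open Finset

/-- The excess of a vertex `v` under `g`: total flow into `v` minus total flow out of `v`. -/
def ex {V : Type*} [Fintype V] (g : V → V → ℝ) (v : V) : ℝ :=
  (∑ u, g u v) - (∑ u, g v u)

/-- Residual capacity of the arc `(u,v)` with respect to capacities `c` and preflow `ρ`. -/
def cRes {V : Type*} (c ρ : V → V → ℝ) (u v : V) : ℝ :=
  c u v - ρ u v + ρ v u

/-- Composition (sum) of a preflow `ρ` with a preflow `η` of the residual network. -/
theorem stmt10 {V : Type*} [Fintype V] (c : V → V → ℝ) (s t : V)
    (hst : s ≠ t)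
    (hc : ∀ u v, 0 ≤ c u v)
    (ρ : V → V → ℝ)
    (hρ : ∀ u v, 0 ≤ ρ u v ∧ ρ u v ≤ c u v)
    (η : V → V → ℝ)
    (hη : ∀ u v, 0 ≤ η u v ∧ η u v ≤ cRes c ρ u v)
    (σ : V → V → ℝ)
    (hσ : ∀ u v, σ u v = max 0 (ρ u v + η u v - ρ v u - η v u)) :
    -- (a) σ = ρ ⊕ η is a preflow
    (∀ u v, 0 ≤ σ u v ∧ σ u v ≤ c u v) ∧
    -- (b) excesses add up
    (∀ v, ex σ v = ex ρ v + ex η v) ∧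
    -- (c) residual capacities
    (∀ u v, cRes c σ u v = cRes c ρ u v - η u v + η v u) ∧
    -- in particular, feasibility is preserved
    ((∀ v, v ≠ s → 0 ≤ ex ρ v) → (∀ v, v ≠ s → 0 ≤ ex η v) →
      ∀ v, v ≠ s → 0 ≤ ex σ v) := by
  have key : ∀ u v, σ u v - σ v u = ρ u v + η u v - ρ v u - η v u := by
    intro u v
    rw [hσ u v, hσ v u]
    rcases le_total 0 (ρ u v + η u v - ρ v u - η v u) with h | h
    · rw [max_eq_right h, max_eq_left (by linarith)]; ring
    · rw [max_eq_left h, max_eq_right (by linarith)]; ring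
  have hb : ∀ v, ex σ v = ex ρ v + ex η v := by
    intro v
    simp only [ex, ← Finset.sum_sub_distrib, ← Finset.sum_add_distrib]
    refine Finset.sum_congr rfl fun u _ => ?_
    rw [key u v]; ring
  refine ⟨fun u v => ?_, hb, fun u v => ?_, fun h1 h2 v hv => ?_⟩
  · rw [hσ u v]
    refine ⟨le_max_left _ _, max_le (hc u v) ?_⟩
    have h1 := (hη u v).2
    have h2 := (hη v u).1
    unfold cRes at h1
    linarith
  · have := key u v
    unfold cRes
    linarith
  · rw [hb v]
    exact add_nonneg (h1 v hv) (h2 v hv)
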